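/- Let S_n be the number of Seymour vertices of the random tournament T_n on n ≥ 2 vertices. Then E(S_n) ≥ n·P(Bin(n−1, 1/2) ≤ (n−1)/2) − (n(n−1)/2)·(3/4)^{n−2}, where Bin(n−1,1/2) denotes a binomial random variable with n−1 trials and success probability 1/2. -/

import Mathlib

/-! Model of the uniform random tournament on `n` vertices.  A sample point assigns a
Boolean to every ordered pair of vertices; only the Booleans indexed by pairs `(i, j)`
with `i < j` are consulted: the edge between `i` and `j` is oriented `i → j` iff that
Boolean is `true`.  Since distinct unordered pairs consult distinct coordinates, under the
uniform probability measure the orientations of the edges are independent and each of the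
two directions has probability `1/2`. -/

/-- The sample space for the random tournament on `n` vertices. -/
abbrev TOmega (n : ℕ) := Fin n → Fin n → Bool

/-- `tadj ω i j` : in the tournament coded by `ω`, the edge between `i` and `j`
is oriented from `i` to `j`. -/
def tadj {n : ℕ} (ω : TOmega n) (i j : Fin n) : Prop :=
  i ≠ j ∧ (if i < j then ω i j = true else ω j i = false)

/-- Uniform probability of an event. -/
noncomputable def tPr {n : ℕ} (E : Set (TOmega n)) : ℝ :=
  (∑ ω : TOmega n, E.indicator (fun _ => (1 : ℝ)) ω) / (Fintype.card (TOmega n) : ℝ)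

/-- Expectation with respect to the uniform probability measure. -/
noncomputable def tEx {n : ℕ} (f : TOmega n → ℝ) : ℝ :=
  (∑ ω : TOmega n, f ω) / (Fintype.card (TOmega n) : ℝ)

/-- The first out-neighborhood of `v`: vertices at directed distance exactly 1. -/
def tN1 {n : ℕ} (ω : TOmega n) (v : Fin n) : Set (Fin n) := {w | tadj ω v w}

/-- The second out-neighborhood of `v`: vertices at directed distance exactly 2. -/
def tN2 {n : ℕ} (ω : TOmega n) (v : Fin n) : Set (Fin n) :=
  {w | w ≠ v ∧ ¬ tadj ω v w ∧ ∃ x, tadj ω v x ∧ tadj ω x w}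

/-- `v` is a Seymour vertex of the tournament coded by `ω`. -/
def tSeymour {n : ℕ} (ω : TOmega n) (v : Fin n) : Prop :=
  (tN1 ω v).ncard ≤ (tN2 ω v).ncard

/-- The number of Seymour vertices. -/
noncomputable def tS {n : ℕ} (ω : TOmega n) : ℕ := {v | tSeymour ω v}.ncard

/-- The expected number of Seymour vertices of the random tournament on `n` vertices. -/
noncomputable def tES (n : ℕ) : ℝ := tEx (fun ω : TOmega n => (tS ω : ℝ))

/-- The variance of the number of Seymour vertices of the random tournament on `n`
vertices. -/
noncomputable def tVarS (n : ℕ) : ℝ := tEx (fun ω : TOmega n => ((tS ω : ℝ) - tES n) ^ 2)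

/-- `P(Bin(m, 1/2) ≤ x)` for a real threshold `x`:  the probability that a binomial random
variable with `m` trials and success probability `1/2` is at most `x`. -/
noncomputable def binHalfCdf (m : ℕ) (x : ℝ) : ℝ :=
  ∑ k ∈ Finset.range (m + 1), if (k : ℝ) ≤ x then (m.choose k : ℝ) * (1 / 2) ^ m else 0

open Finset

theorem tadj_irrefl {n : ℕ} (ω : TOmega n) (i : Fin n) : ¬ tadj ω i i := fun h => h.1 rfl

theorem tadj_swap {n : ℕ} (ω : TOmega n) {i j : Fin n} (h : i ≠ j) :
    tadj ω j i ↔ ¬ tadj ω i j := by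
  rcases lt_or_gt_of_ne h with h' | h' <;> simp [tadj, h, h.symm, h', h'.asymm]

theorem tEx_mono {n : ℕ} {f g : TOmega n → ℝ} (h : ∀ ω, f ω ≤ g ω) : tEx f ≤ tEx g := by
  unfold tEx
  gcongr with ω
  exact h ω

theorem tEx_sum {n : ℕ} {ι : Type*} (s : Finset ι) (f : ι → TOmega n → ℝ) :
    tEx (fun ω => ∑ i ∈ s, f i ω) = ∑ i ∈ s, tEx (f i) := by
  simp only [tEx]
  rw [sum_comm, sum_div]

theorem tEx_sub {n : ℕ} (f g : TOmega n → ℝ) :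
    tEx (fun ω => f ω - g ω) = tEx f - tEx g := by
  simp only [tEx, sum_sub_distrib, sub_div]

open Classical in
/-- The probability of the event `P`, as the expectation of its indicator. -/
noncomputable def prob {n : ℕ} (P : TOmega n → Prop) : ℝ :=
  tEx fun ω => if P ω then 1 else 0

/-- Reverse the edge `e`. -/
def flipEdge {n : ℕ} (e : Fin n × Fin n) (ω : TOmega n) : TOmega n := fun i j =>
  if (i, j) = e ∨ (j, i) = e then !ω i j else ω i j

theorem flipEdge_involutive {n : ℕ} (e : Fin n × Fin n) :
    Function.Involutive (flipEdge e) := by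
  intro ω
  funext i j
  by_cases h : (i, j) = e ∨ (j, i) = e <;> simp [flipEdge, h]

theorem tadj_flipEdge_self {n : ℕ} (ω : TOmega n) {e : Fin n × Fin n} (he : e.1 ≠ e.2) :
    tadj (flipEdge e ω) e.1 e.2 ↔ ¬ tadj ω e.1 e.2 := by
  rcases lt_or_gt_of_ne he with h' | h' <;> simp [tadj, flipEdge, he, h', h'.asymm]

theorem tadj_flipEdge_of_ne {n : ℕ} (ω : TOmega n) {e : Fin n × Fin n} {i j : Fin n}
    (h : (i, j) ≠ e) (h' : (j, i) ≠ e) : tadj (flipEdge e ω) i j ↔ tadj ω i j := by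
  simp [tadj, flipEdge, h, h']

theorem prob_forall_tadj {n : ℕ} (E : Finset (Fin n × Fin n))
    (hE : ∀ p ∈ E, p.1 ≠ p.2 ∧ p.swap ∉ E) :
    prob (fun ω => ∀ p ∈ E, tadj ω p.1 p.2) = (1 / 2) ^ #E := by
  classical
  induction E using Finset.induction_on with
  | empty => simp [prob, tEx]
  | insert e E heE ih =>
    have ih := ih fun p hp => ⟨(hE p (mem_insert_of_mem hp)).1,
      fun h => (hE p (mem_insert_of_mem hp)).2 (mem_insert_of_mem h)⟩
    have he := (hE e (mem_insert_self _ _)).1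
    have hflip : prob (fun ω => ∀ p ∈ insert e E, tadj ω p.1 p.2) =
        prob (fun ω => ¬ tadj ω e.1 e.2 ∧ ∀ p ∈ E, tadj ω p.1 p.2) := by
      simp only [prob, tEx]
      congr 1
      refine Fintype.sum_bijective (flipEdge e) (flipEdge_involutive e).bijective _ _ fun ω => ?_
      congr 1
      rw [forall_mem_insert, tadj_flipEdge_self ω he, not_not]
      refine propext (and_congr_right fun _ => forall₂_congr fun p hp => ?_)
      refine (tadj_flipEdge_of_ne ω ?_ ?_).symm
      · rintro rfl
        exact heE hp
      · rintro rfl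
        exact (hE p (mem_insert_of_mem hp)).2 (mem_insert_self _ _)
    have hsplit : prob (fun ω => ∀ p ∈ E, tadj ω p.1 p.2) =
        prob (fun ω => ∀ p ∈ insert e E, tadj ω p.1 p.2) +
        prob (fun ω => ¬ tadj ω e.1 e.2 ∧ ∀ p ∈ E, tadj ω p.1 p.2) := by
      simp only [prob, tEx, ← add_div, ← sum_add_distrib]
      congr 1
      refine sum_congr rfl fun ω _ => ?_
      by_cases h : tadj ω e.1 e.2 <;> simp [h]
    rw [card_insert_of_notMem heE, pow_succ, ← ih, hsplit, ← hflip]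
    ring

open Classical in
/-- The out-neighborhood of `v` as a finset. -/
noncomputable def outNbrs {n : ℕ} (ω : TOmega n) (v : Fin n) : Finset (Fin n) :=
  {w | tadj ω v w}

theorem mem_outNbrs {n : ℕ} {ω : TOmega n} {v w : Fin n} : w ∈ outNbrs ω v ↔ tadj ω v w := by
  simp [outNbrs]

theorem coe_outNbrs {n : ℕ} (ω : TOmega n) (v : Fin n) : (outNbrs ω v : Set (Fin n)) = tN1 ω v := by
  ext w
  simp [mem_outNbrs, tN1]

theorem outNbrs_subset {n : ℕ} (ω : TOmega n) (v : Fin n) : outNbrs ω v ⊆ univ.erase v := by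
  intro w hw
  simpa using (mem_outNbrs.1 hw).1.symm

theorem prob_outNbrs_eq_and {n : ℕ} {v w : Fin n} {A B : Finset (Fin n)} (hwv : w ≠ v)
    (hA : v ∉ A) (hvB : v ∉ B) (hwB : w ∉ B) :
    prob (fun ω => outNbrs ω v = A ∧ ∀ x ∈ B, tadj ω w x) = (1 / 2) ^ (n - 1 + #B) := by
  classical
  let f : Fin n → Fin n × Fin n := fun x => if x ∈ A then (v, x) else (x, v)
  let E := (univ.erase v).image f ∪ B.image (fun x => (w, x))
  have hf : ∀ x, (x ∈ A ∧ f x = (v, x)) ∨ (x ∉ A ∧ f x = (x, v)) := by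
    intro x
    by_cases h : x ∈ A <;> simp [f, h]
  have hmem : ∀ p, p ∈ E ↔ (∃ x, x ≠ v ∧ f x = p) ∨ ∃ x ∈ B, (w, x) = p := by
    intro p
    simp [E]
  have hcard : #E = n - 1 + #B := by
    rw [card_union_of_disjoint, card_image_of_injOn, card_image_of_injective, card_erase_of_mem,
      card_univ, Fintype.card_fin]
    · exact mem_univ _
    · exact fun x y h => congrArg Prod.snd h
    · intro x hx y hy hxy
      have hx : x ≠ v := by simpa using hx
      have hy : y ≠ v := by simpa using hy
      rcases hf x with ⟨_, h1⟩ | ⟨_, h1⟩ <;> rcases hf y with ⟨_, h2⟩ | ⟨_, h2⟩ <;>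
        simp_all [Prod.ext_iff]
    · rw [disjoint_left]
      simp only [mem_image, not_exists, not_and]
      rintro p ⟨x, _, rfl⟩ y hy h
      rcases hf x with ⟨_, h1⟩ | ⟨_, h1⟩ <;> simp_all [Prod.ext_iff]
  rw [← hcard, ← prob_forall_tadj E]
  · congr 1
    funext ω
    refine propext ⟨fun ⟨h1, h2⟩ p hp => ?_, fun h => ⟨?_, fun x hx => ?_⟩⟩
    · rcases (hmem p).1 hp with ⟨x, hx, rfl⟩ | ⟨x, hx, rfl⟩
      · subst h1
        rcases hf x with ⟨h3, h4⟩ | ⟨h3, h4⟩ <;> rw [h4]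
        · exact mem_outNbrs.1 h3
        · exact (tadj_swap ω hx.symm).2 fun h => h3 (mem_outNbrs.2 h)
      · exact h2 x hx
    · ext x
      rw [mem_outNbrs]
      by_cases hx : x = v
      · subst hx
        simp [hA, tadj_irrefl]
      · have h3 := h (f x) ((hmem _).2 (Or.inl ⟨x, hx, rfl⟩))
        rcases hf x with ⟨h1, h2⟩ | ⟨h1, h2⟩ <;> rw [h2] at h3
        · exact iff_of_true h3 h1
        · exact iff_of_false ((tadj_swap ω (Ne.symm hx)).1 h3) h1
    · exact h (w, x) ((hmem _).2 (Or.inr ⟨x, hx, rfl⟩))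
  · intro p hp
    rw [hmem] at hp
    rw [hmem]
    rcases hp with ⟨x, hx, rfl⟩ | ⟨x, hx, rfl⟩
    · rcases hf x with ⟨h1, h2⟩ | ⟨h1, h2⟩ <;> rw [h2]
      · refine ⟨Ne.symm hx, ?_⟩
        rintro (⟨y, hy, h⟩ | ⟨y, hy, h⟩)
        · rcases hf y with ⟨h3, h4⟩ | ⟨h3, h4⟩ <;> simp_all [Prod.ext_iff]
        · simp_all [Prod.ext_iff]
      · refine ⟨hx, ?_⟩
        rintro (⟨y, hy, h⟩ | ⟨y, hy, h⟩)
        · rcases hf y with ⟨h3, h4⟩ | ⟨h3, h4⟩ <;> simp_all [Prod.ext_iff]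
        · simp_all [Prod.ext_iff]
    · refine ⟨fun h => hwB (by simp_all), ?_⟩
      rintro (⟨y, hy, h⟩ | ⟨y, hy, h⟩)
      · rcases hf y with ⟨h3, h4⟩ | ⟨h3, h4⟩ <;> simp_all [Prod.ext_iff]
      · simp_all [Prod.ext_iff]

theorem prob_eq_sum_outNbrs {n : ℕ} (v : Fin n) (S : Finset (Fin n)) (P : TOmega n → Prop)
    (hS : ∀ ω, P ω → outNbrs ω v ⊆ S) :
    prob P = ∑ A ∈ S.powerset, prob (fun ω => outNbrs ω v = A ∧ P ω) := by
  classical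
  simp only [prob]
  rw [← tEx_sum]
  congr 1
  funext ω
  by_cases h : P ω
  · simp [h, hS ω h]
  · simp [h]

theorem prob_outNbrs_card_le {n : ℕ} (hn : 2 ≤ n) (v : Fin n) :
    prob (fun ω => (#(outNbrs ω v) : ℝ) ≤ ((n : ℝ) - 1) / 2) =
      binHalfCdf (n - 1) (((n : ℝ) - 1) / 2) := by
  classical
  have : Nontrivial (Fin n) := Fin.nontrivial_iff_two_le.2 hn
  obtain ⟨w, hw⟩ := exists_ne v
  rw [prob_eq_sum_outNbrs v (univ.erase v) _ fun ω _ => outNbrs_subset ω v]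
  have h : ∀ A ∈ (univ.erase v).powerset,
      prob (fun ω => outNbrs ω v = A ∧ (#(outNbrs ω v) : ℝ) ≤ ((n : ℝ) - 1) / 2) =
        (fun k : ℕ => if (k : ℝ) ≤ ((n : ℝ) - 1) / 2 then (1 / 2 : ℝ) ^ (n - 1) else 0) #A := by
    intro A hA
    have hvA : v ∉ A := fun h => by simpa using mem_powerset.1 hA h
    have h1 := prob_outNbrs_eq_and (B := ∅) hw hvA (by simp) (by simp)
    simp only [notMem_empty, false_imp_iff, implies_true, and_true, card_empty, add_zero] at h1
    dsimp only
    split_ifs with hc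
    · rw [← h1]
      congr 1
      funext ω
      exact propext ⟨And.left, fun h => ⟨h, h ▸ hc⟩⟩
    · have : (fun ω : TOmega n => outNbrs ω v = A ∧ (#(outNbrs ω v) : ℝ) ≤ ((n : ℝ) - 1) / 2) =
          fun _ => False := by
        funext ω
        exact eq_false fun h => hc (h.1 ▸ h.2)
      rw [this]
      simp [prob, tEx]
  rw [sum_congr rfl h,
    sum_powerset_apply_card fun k : ℕ =>
      if (k : ℝ) ≤ ((n : ℝ) - 1) / 2 then (1 / 2 : ℝ) ^ (n - 1) else 0,
    card_erase_of_mem (mem_univ _), card_univ,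
    Fintype.card_fin, binHalfCdf]
  refine sum_congr rfl fun k _ => ?_
  split_ifs <;> simp

theorem prob_no_two_path {n : ℕ} (hn : 2 ≤ n) {v w : Fin n} (hw : w ≠ v) :
    prob (fun ω => w ∉ outNbrs ω v ∧ ∀ x ∈ outNbrs ω v, tadj ω w x) =
      1 / 2 * (3 / 4) ^ (n - 2) := by
  classical
  rw [prob_eq_sum_outNbrs v ((univ.erase v).erase w) _
    fun ω h => subset_erase.2 ⟨outNbrs_subset ω v, h.1⟩]
  have h : ∀ A ∈ ((univ.erase v).erase w).powerset,
      prob (fun ω => outNbrs ω v = A ∧ w ∉ outNbrs ω v ∧ ∀ x ∈ outNbrs ω v, tadj ω w x) =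
        (1 / 2 : ℝ) ^ (n - 1) * ((1 / 2) ^ #A * 1 ^ (#((univ.erase v).erase w) - #A)) := by
    intro A hA
    have hvA : v ∉ A := fun h => by simpa using mem_powerset.1 hA h
    have hwA : w ∉ A := fun h => by simpa using mem_powerset.1 hA h
    rw [one_pow, mul_one, ← pow_add, ← prob_outNbrs_eq_and hw hvA hvA hwA]
    congr 1
    funext ω
    refine propext (and_congr_right fun h => ?_)
    simp [h, hwA]
  rw [sum_congr rfl h, ← mul_sum, sum_pow_mul_eq_add_pow, card_erase_of_mem (by simpa using hw),
    card_erase_of_mem (mem_univ _), card_univ, Fintype.card_fin]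
  obtain ⟨m, rfl⟩ := Nat.exists_eq_add_of_le' hn
  simp only [Nat.add_sub_cancel, show m + 2 - 1 = m + 1 by omega]
  rw [pow_succ, mul_right_comm, ← mul_pow, mul_comm]
  norm_num

theorem tSeymour_of_card_le {n : ℕ} {ω : TOmega n} {v : Fin n}
    (hd : (#(outNbrs ω v) : ℝ) ≤ ((n : ℝ) - 1) / 2)
    (h : ∀ w, w ≠ v → ¬ (w ∉ outNbrs ω v ∧ ∀ x ∈ outNbrs ω v, tadj ω w x)) :
    tSeymour ω v := by
  classical
  have hN2 : ((univ.erase v \ outNbrs ω v : Finset (Fin n)) : Set (Fin n)) ⊆ tN2 ω v := by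
    intro w hw
    have hw : w ≠ v ∧ w ∉ outNbrs ω v := by simpa using hw
    have h1 := h w hw.1
    push Not at h1
    obtain ⟨x, hx, hwx⟩ := h1 hw.2
    have hne : w ≠ x := fun h => hw.2 (h ▸ hx)
    exact ⟨hw.1, fun h => hw.2 (mem_outNbrs.2 h), x, mem_outNbrs.1 hx, (tadj_swap ω hne).2 hwx⟩
  have hle := Set.ncard_le_ncard hN2 (Set.toFinite _)
  rw [Set.ncard_coe_finset, card_sdiff_of_subset (outNbrs_subset ω v),
    card_erase_of_mem (mem_univ _), card_univ, Fintype.card_fin] at hle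
  unfold tSeymour
  rw [← coe_outNbrs, Set.ncard_coe_finset]
  have : 2 * #(outNbrs ω v) + 1 ≤ n := by
    have : 2 * (#(outNbrs ω v) : ℝ) + 1 ≤ n := by linarith
    exact_mod_cast this
  omega

open Classical in
theorem ite_sub_sum_ite_le {ι : Type*} (s : Finset ι) {P Q : Prop} {B : ι → Prop}
    (h : P → ¬ Q → ∃ i ∈ s, B i) :
    (if P then (1 : ℝ) else 0) - ∑ i ∈ s, (if B i then 1 else 0) ≤ if Q then 1 else 0 := by
  have hnonneg : ∀ i ∈ s, (0 : ℝ) ≤ if B i then 1 else 0 := by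
    intro i _
    split_ifs <;> norm_num
  have h0 := sum_nonneg hnonneg
  by_cases hP : P <;> by_cases hQ : Q <;> simp only [hP, hQ, if_true, if_false]
  · linarith
  · obtain ⟨i, hi, hb⟩ := h hP hQ
    have h1 := single_le_sum hnonneg hi
    rw [if_pos hb] at h1
    linarith
  · linarith
  · linarith

theorem le_prob_tSeymour {n : ℕ} (hn : 2 ≤ n) (v : Fin n) :
    binHalfCdf (n - 1) (((n : ℝ) - 1) / 2) - ((n : ℝ) - 1) * (1 / 2 * (3 / 4) ^ (n - 2)) ≤
      prob (fun ω => tSeymour ω v) := by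
  classical
  have hsum : ∑ w ∈ univ.erase v,
      prob (fun ω => w ∉ outNbrs ω v ∧ ∀ x ∈ outNbrs ω v, tadj ω w x) =
        ((n : ℝ) - 1) * (1 / 2 * (3 / 4) ^ (n - 2)) := by
    rw [sum_congr rfl fun w hw => prob_no_two_path hn (ne_of_mem_erase hw), sum_const,
      card_erase_of_mem (mem_univ _), card_univ, Fintype.card_fin, nsmul_eq_mul,
      Nat.cast_sub (by omega), Nat.cast_one]
  rw [← prob_outNbrs_card_le hn v, ← hsum]
  simp only [prob]
  rw [← tEx_sum, ← tEx_sub]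
  refine tEx_mono fun ω => ite_sub_sum_ite_le _ fun hd hS => ?_
  by_contra hcon
  exact hS (tSeymour_of_card_le hd fun w hw hb => hcon ⟨w, mem_erase.2 ⟨hw, mem_univ w⟩, hb⟩)

theorem tES_eq_sum_prob (n : ℕ) : tES n = ∑ v, prob (fun ω : TOmega n => tSeymour ω v) := by
  classical
  simp only [tES, prob]
  rw [← tEx_sum]
  congr 1
  funext ω
  rw [tS, Set.ncard_eq_toFinset_card', sum_boole]
  congr 2
  ext v
  simp

/-- Lower bound on the expected number of Seymour vertices of the random tournament on
`n ≥ 2` vertices: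
`E(S_n) ≥ n · P(Bin(n-1, 1/2) ≤ (n-1)/2) − (n(n-1)/2) · (3/4)^(n-2)`. -/
theorem expected_seymour_lower (n : ℕ) (hn : 2 ≤ n) :
    (n : ℝ) * binHalfCdf (n - 1) (((n : ℝ) - 1) / 2)
      - ((n : ℝ) * ((n : ℝ) - 1) / 2) * (3 / 4 : ℝ) ^ (n - 2) ≤ tES n := by
  calc (n : ℝ) * binHalfCdf (n - 1) (((n : ℝ) - 1) / 2)
        - ((n : ℝ) * ((n : ℝ) - 1) / 2) * (3 / 4 : ℝ) ^ (n - 2)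
      = ∑ _v : Fin n, (binHalfCdf (n - 1) (((n : ℝ) - 1) / 2)
          - ((n : ℝ) - 1) * (1 / 2 * (3 / 4) ^ (n - 2))) := by
        rw [sum_const, card_univ, Fintype.card_fin, nsmul_eq_mul]
        ring
    _ ≤ ∑ v, prob (fun ω : TOmega n => tSeymour ω v) :=
        sum_le_sum fun v _ => le_prob_tSeymour hn v
    _ = tES n := (tES_eq_sum_prob n).symm
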